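/- Let A = {a,b,c} and consider the five-voter profiles R (voters 1 and 2: a ≻ b ≻ c; voters 3 and 4: b ≻ c ≻ a; voter 5: c ≻ a ≻ b) and R' (voters 1 and 2: a ≻ b ≻ c; voter 3: b ≻ c ≻ a; voters 4 and 5: c ≻ a ≻ b), which differ only in the preference of voter 4. Then ML(R) = {p} with p(a) = 3/5, p(b) = p(c) = 1/5, and ML(R') = {q} with q(c) = 3/5, q(a) = q(b) = 1/5, and q ≻_4^PC p with respect to voter 4's preference b ≻ c ≻ a in R. Consequently, any social decision scheme that selects a maximal lottery at every profile is not PC-strategyproof. -/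

import Mathlib

open scoped Classical
open Finset

noncomputable section

/-- A strict preference relation: a strict linear (total) order on `A`. -/
abbrev Pref (A : Type*) : Type _ := {r : A → A → Prop // IsStrictTotalOrder A r}

/-- A lottery over the finite set `A` of alternatives. -/
def Lottery (A : Type*) [Fintype A] : Type _ :=
  {p : A → ℝ // (∀ x, 0 ≤ p x) ∧ ∑ x : A, p x = 1}

variable {A : Type*} [Fintype A]

/-- `∑_{x ≻ y} p(x) q(y)`. -/
def PCsum (r : Pref A) (p q : A → ℝ) : ℝ :=
  ∑ x : A, ∑ y : A, if r.val x y then p x * q y else 0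

/-- Pairwise-comparison (weak) preference over lotteries: `p ≿^PC q`. -/
def PCge (r : Pref A) (p q : Lottery A) : Prop :=
  PCsum r q.val p.val ≤ PCsum r p.val q.val

/-- Pairwise-comparison strict preference over lotteries: `p ≻^PC q`. -/
def PCgt (r : Pref A) (p q : Lottery A) : Prop :=
  PCsum r q.val p.val < PCsum r p.val q.val

/-- An SDS on a fixed electorate `N` is PC-strategyproof if every voter always
weakly PC-prefers the truthful outcome to any outcome from a unilateral deviation. -/
def PCStrategyproof {N : Type*} (f : (N → Pref A) → Lottery A) : Prop :=
  ∀ (i : N) (R R' : N → Pref A), (∀ j, j ≠ i → R j = R' j) → PCge (R i) (f R) (f R')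

/-- Majority margin `g_R(x,y)`. -/
def margin {I : Type*} [Fintype I] (R : I → Pref A) (x y : A) : ℤ :=
  ((univ.filter fun i => (R i).val x y).card : ℤ) -
    ((univ.filter fun i => (R i).val y x).card : ℤ)

/-- Maximal lotteries: `p ∈ ML(R)` iff `∑_{x,y} p(x) q(y) g_R(x,y) ≥ 0` for all lotteries `q`. -/
def MaximalLottery {I : Type*} [Fintype I] (R : I → Pref A) (p : Lottery A) : Prop :=
  ∀ q : Lottery A, 0 ≤ ∑ x : A, ∑ y : A, p.val x * q.val y * ((margin R x y : ℤ) : ℝ)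

/-- A sum over a three-element type. -/
lemma sum_eq_of_cover {A M : Type*} [Fintype A] [AddCommMonoid M] {x y z : A}
    (hxy : x ≠ y) (hxz : x ≠ z) (hyz : y ≠ z) (hcover : ∀ u : A, u = x ∨ u = y ∨ u = z)
    (F : A → M) : ∑ u : A, F u = F x + F y + F z := by
  have huniv : (univ : Finset A) = {x, y, z} := by
    ext u
    simpa using hcover u
  rw [huniv, sum_insert (by simp [hxy, hxz]), sum_pair hyz, add_assoc]

/-- The values of the preference relation `x ≻ y ≻ z` on the three alternatives. -/
lemma Pref.eval_of_chain {A : Type*} {r : Pref A} {x y z : A} (h : r.val x y ∧ r.val y z) :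
    r.val x y ∧ r.val y z ∧ r.val x z ∧ ¬ r.val y x ∧ ¬ r.val z y ∧ ¬ r.val z x ∧
      ¬ r.val x x ∧ ¬ r.val y y ∧ ¬ r.val z z := by
  have := r.property
  have hxz := _root_.trans h.1 h.2
  exact ⟨h.1, h.2, hxz, asymm_of r.val h.1, asymm_of r.val h.2, asymm_of r.val hxz,
    irrefl_of r.val x, irrefl_of r.val y, irrefl_of r.val z⟩

/-- A preference relation on three alternatives is determined by the ranking `x ≻ y ≻ z`. -/
lemma Pref.eq_of_chain {A : Type*} {r s : Pref A} {x y z : A}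
    (hcover : ∀ u : A, u = x ∨ u = y ∨ u = z)
    (hr : r.val x y ∧ r.val y z) (hs : s.val x y ∧ s.val y z) : r = s := by
  have er := Pref.eval_of_chain hr
  have es := Pref.eval_of_chain hs
  refine Subtype.ext (funext fun u => funext fun v => propext ?_)
  rcases hcover u with rfl | rfl | rfl <;> rcases hcover v with rfl | rfl | rfl <;> tauto

lemma margin_self {A I : Type*} [Fintype A] [Fintype I] (R : I → Pref A) (x : A) :
    margin R x x = 0 := by
  simp [margin]

lemma margin_swap {A I : Type*} [Fintype A] [Fintype I] (R : I → Pref A) (x y : A) :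
    margin R y x = - margin R x y := by
  simp [margin]

/-- The lottery that puts probability one on `x`. -/
def Lottery.pure {A : Type*} [Fintype A] (x : A) : Lottery A :=
  ⟨Pi.single x 1, fun u => by
    by_cases h : u = x
    · subst h; simp
    · simp [h], by simp⟩

/-- The unique maximal lottery of a majority cycle `x, y, z` with margins `1`, `3` and `1`. -/
lemma maximalLottery_iff_of_cycle {A I : Type*} [Fintype A] [Fintype I] {x y z : A}
    (hxy : x ≠ y) (hxz : x ≠ z) (hyz : y ≠ z) (hcover : ∀ u : A, u = x ∨ u = y ∨ u = z)
    {R : I → Pref A} (mxy : margin R x y = 1) (myz : margin R y z = 3) (mzx : margin R z x = 1)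
    (p : Lottery A) :
    MaximalLottery R p ↔ p.val x = 3 / 5 ∧ p.val y = 1 / 5 ∧ p.val z = 1 / 5 := by
  have myx := margin_swap R x y
  have mzy := margin_swap R y z
  have mxz := margin_swap R z x
  rw [mxy] at myx
  rw [myz] at mzy
  rw [mzx] at mxz
  have hsum := p.property.2
  rw [sum_eq_of_cover hxy hxz hyz hcover] at hsum
  simp only [MaximalLottery, sum_eq_of_cover hxy hxz hyz hcover, margin_self, mxy, myz, mzx,
    myx, mzy, mxz]
  constructor
  · intro h
    have hx := h (Lottery.pure x)
    have hy := h (Lottery.pure y)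
    have hz := h (Lottery.pure z)
    simp [Lottery.pure, hxy, hxz, hyz, hxy.symm, hxz.symm, hyz.symm] at hx hy hz
    refine ⟨?_, ?_, ?_⟩ <;> linarith
  · rintro ⟨hx, hy, hz⟩ q
    rw [hx, hy, hz]
    push_cast
    exact le_of_eq (by ring)

/-- Majority margins as a sum of the voters' individual comparisons. -/
lemma margin_eq_sum {A I : Type*} [Fintype A] [Fintype I] (R : I → Pref A) (x y : A) :
    margin R x y = ∑ i : I,
      ((if (R i).val x y then 1 else 0) - (if (R i).val y x then 1 else 0)) := by
  simp [margin, sum_sub_distrib]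

/-- In the two 5-voter profiles `R` and `R'` over `A = {a,b,c}` that differ
only in voter 4's preferences, the unique maximal lotteries are `(3/5, 1/5, 1/5)` on `(a,b,c)`
and `(1/5, 1/5, 3/5)` respectively, voter 4 strictly PC-prefers the latter with his truthful
preference `b ≻ c ≻ a`, and hence every SDS selecting maximal lotteries fails
PC-strategyproofness. -/
theorem maximal_lotteries_not_pc_strategyproof
    {A : Type*} [Fintype A]
    (a b c : A) (hab : a ≠ b) (hac : a ≠ c) (hbc : b ≠ c)
    (hcover : ∀ u : A, u = a ∨ u = b ∨ u = c)
    (R R' : Fin 5 → Pref A)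
    (hR12 : ∀ i : Fin 5, i.val < 2 → (R i).val a b ∧ (R i).val b c)
    (hR34 : ∀ i : Fin 5, 2 ≤ i.val → i.val < 4 → (R i).val b c ∧ (R i).val c a)
    (hR5 : (R 4).val c a ∧ (R 4).val a b)
    (hR'12 : ∀ i : Fin 5, i.val < 2 → (R' i).val a b ∧ (R' i).val b c)
    (hR'3 : (R' 2).val b c ∧ (R' 2).val c a)
    (hR'45 : ∀ i : Fin 5, 3 ≤ i.val → (R' i).val c a ∧ (R' i).val a b) :
    (∀ p : Lottery A, MaximalLottery R p ↔
      (p.val a = 3/5 ∧ p.val b = 1/5 ∧ p.val c = 1/5)) ∧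
    (∀ q : Lottery A, MaximalLottery R' q ↔
      (q.val c = 3/5 ∧ q.val a = 1/5 ∧ q.val b = 1/5)) ∧
    (∀ p q : Lottery A, MaximalLottery R p → MaximalLottery R' q → PCgt (R 3) q p) ∧
    (∀ f : (Fin 5 → Pref A) → Lottery A,
      (∀ S : Fin 5 → Pref A, MaximalLottery S (f S)) → ¬ PCStrategyproof f) := by
  have hbca : ∀ u : A, u = b ∨ u = c ∨ u = a := fun u => or_assoc.1 (or_comm.1 (hcover u))
  have hcab : ∀ u : A, u = c ∨ u = a ∨ u = b := fun u => or_assoc.1 (or_comm.1 (hbca u))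
  have e0 := Pref.eval_of_chain (hR12 0 (by decide))
  have e1 := Pref.eval_of_chain (hR12 1 (by decide))
  have e2 := Pref.eval_of_chain (hR34 2 (by decide) (by decide))
  have e3 := Pref.eval_of_chain (hR34 3 (by decide) (by decide))
  have e4 := Pref.eval_of_chain hR5
  have e0' := Pref.eval_of_chain (hR'12 0 (by decide))
  have e1' := Pref.eval_of_chain (hR'12 1 (by decide))
  have e2' := Pref.eval_of_chain hR'3
  have e3' := Pref.eval_of_chain (hR'45 3 (by decide))
  have e4' := Pref.eval_of_chain (hR'45 4 (by decide))
  have hML : ∀ p : Lottery A, MaximalLottery R p ↔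
      (p.val a = 3/5 ∧ p.val b = 1/5 ∧ p.val c = 1/5) := by
    apply maximalLottery_iff_of_cycle hab hac hbc hcover <;>
      rw [margin_eq_sum, Fin.sum_univ_five] <;>
      simp [e0, e1, e2, e3, e4]
  have hML' : ∀ q : Lottery A, MaximalLottery R' q ↔
      (q.val c = 3/5 ∧ q.val a = 1/5 ∧ q.val b = 1/5) := by
    apply maximalLottery_iff_of_cycle hac.symm hbc.symm hab hcab <;>
      rw [margin_eq_sum, Fin.sum_univ_five] <;>
      simp [e0', e1', e2', e3', e4']
  have hgt : ∀ p q : Lottery A, MaximalLottery R p → MaximalLottery R' q →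
      PCgt (R 3) q p := by
    intro p q hp hq
    obtain ⟨pa, pb, pc⟩ := (hML p).1 hp
    obtain ⟨qc, qa, qb⟩ := (hML' q).1 hq
    simp only [PCgt, PCsum, sum_eq_of_cover hab hac hbc hcover, e3, pa, pb, pc, qa, qb, qc,
      if_true, if_false]
    norm_num
  refine ⟨hML, hML', hgt, fun f hf hsp => ?_⟩
  have hagree : ∀ j, j ≠ 3 → R j = R' j := by
    intro j hj
    fin_cases j
    · exact Pref.eq_of_chain hcover (hR12 0 (by decide)) (hR'12 0 (by decide))
    · exact Pref.eq_of_chain hcover (hR12 1 (by decide)) (hR'12 1 (by decide))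
    · exact Pref.eq_of_chain hbca
        (hR34 2 (by decide) (by decide)) hR'3
    · exact absurd rfl hj
    · exact Pref.eq_of_chain hcab hR5 (hR'45 4 (by decide))
  exact absurd (hgt _ _ (hf R) (hf R')) (not_lt.2 (hsp 3 R R' hagree))

end
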